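/- With D_J the MDP constructed from a row-stochastic matrix J ∈ ℚ^{n×m} and r ≥ 1 as in the context: if there are no nonnegative matrices A ∈ ℝ^{n×r} and W ∈ ℝ^{r×m} with J = A·W, then for every memoryless strategy α and all subdistributions μ₁ supported on the left-part states and μ₂ supported on the right-part states, there exists a word w ∈ L* with μ₁·M_α(w)·1 ≠ μ₂·M_α(w)·1. -/

import Mathlib

open Matrix

/-- A labelled Markov decision process: a partial probabilistic transition function
`phi : S × A ⇀ (S → ℝ)` and a labelling function. -/
structure MDP (S A L : Type) where
  phi : S → A → Option (S → ℝ)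
  label : S → L

namespace MDP

variable {S A L : Type} [Fintype S] [Fintype A] [DecidableEq S]

/-- The MDP data is well-formed: every state has an available action, and every
defined `phi s m` is a probability distribution on `S`. -/
def IsValid (D : MDP S A L) : Prop :=
  (∀ s, ∃ m, (D.phi s m).isSome) ∧
    ∀ s m d, D.phi s m = some d → (∀ t, 0 ≤ d t) ∧ (∑ t, d t) = 1

/-- Transition probabilities, with `0` for unavailable actions. -/
def trans (D : MDP S A L) (s : S) (m : A) : S → ℝ :=
  (D.phi s m).getD 0

/-- A memoryless strategy: for each state a probability distribution on the
available actions. -/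
def IsStrategy (D : MDP S A L) (α : S → A → ℝ) : Prop :=
  ∀ s, (∀ m, 0 ≤ α s m) ∧ (∑ m, α s m) = 1 ∧ ∀ m, D.phi s m = none → α s m = 0

/-- Transition probabilities of the induced labelled Markov chain `D(α)`. -/
def tau (D : MDP S A L) (α : S → A → ℝ) (s t : S) : ℝ :=
  ∑ m, α s m * D.trans s m t

/-- The matrix `M_α(a)`. -/
def Mmat [DecidableEq L] (D : MDP S A L) (α : S → A → ℝ) (a : L) : Matrix S S ℝ :=
  Matrix.of fun s t => if D.label s = a then D.tau α s t else 0

/-- The matrix `M_α(w)` for a word `w ∈ L*` (identity for the empty word). -/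
def Mword [DecidableEq L] (D : MDP S A L) (α : S → A → ℝ) (w : List L) : Matrix S S ℝ :=
  (w.map (D.Mmat α)).prod

/-- A memoryless deterministic (MD) strategy, viewed as a function `S → A`
choosing an available action in each state. -/
def IsMD (D : MDP S A L) (β : S → A) : Prop := ∀ s, (D.phi s (β s)).isSome

/-- The memoryless strategy corresponding to an MD strategy. -/
def mdStrat [DecidableEq A] (β : S → A) : S → A → ℝ :=
  fun s m => if m = β s then 1 else 0

end MDP

/-- The Dirac distribution on a state. -/
def dirac {S : Type} [DecidableEq S] (x : S) : S → ℝ := fun y => if y = x then 1 else 0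

/-- States of the MDP `D_J`: `s, sᵢ, sᵢ', p_j` (left part) and `t, tᵢ, t_k', q_j`
(right part). -/
inductive NMFState (n m r : ℕ) where
  | s | si (i : Fin n) | si' (i : Fin n) | p (j : Fin m)
  | t | ti (i : Fin n) | ti' (k : Fin r) | q (j : Fin m)
deriving DecidableEq, Fintype

/-- Labels: `aᵢ` for `sᵢ, tᵢ`; `b_j` for `p_j, q_j`; `c` for the rest. -/
inductive NMFLabel (n m : ℕ) where
  | a (i : Fin n) | b (j : Fin m) | c
deriving DecidableEq, Fintype

/-- Actions: `m_{i,k}` (for the `tᵢ`), `m'_{k,j}` (for the `t_k'`), and a unique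
action for all other states. -/
abbrev NMFAct (r m : ℕ) : Type := Fin r ⊕ (Fin m ⊕ Unit)

/-- The transition function of the MDP `D_J`. -/
noncomputable def nmfPhi (n m r : ℕ) (J : Matrix (Fin n) (Fin m) ℚ) :
    NMFState n m r → NMFAct r m → Option (NMFState n m r → ℝ)
  | .s, .inr (.inr _) => some fun u => match u with | .si _ => 1 / (n : ℝ) | _ => 0
  | .si i, .inr (.inr _) => some (dirac (.si' i))
  | .si' i, .inr (.inr _) => some fun u => match u with | .p j => ((J i j : ℚ) : ℝ) | _ => 0
  | .p _, .inr (.inr _) => some (dirac .s)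
  | .t, .inr (.inr _) => some fun u => match u with | .ti _ => 1 / (n : ℝ) | _ => 0
  | .ti _, .inl k => some (dirac (.ti' k))
  | .ti' _, .inr (.inl j) => some (dirac (.q j))
  | .q _, .inr (.inr _) => some (dirac .t)
  | _, _ => none

/-- The labelling function of the MDP `D_J`. -/
def nmfLabel (n m r : ℕ) : NMFState n m r → NMFLabel n m
  | .si i => .a i
  | .ti i => .a i
  | .p j => .b j
  | .q j => .b j
  | _ => .c

/-- The MDP `D_J` constructed from the row-stochastic matrix `J` and `r`. -/
noncomputable def nmfMDP (n m r : ℕ) (J : Matrix (Fin n) (Fin m) ℚ) :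
    MDP (NMFState n m r) (NMFAct r m) (NMFLabel n m) :=
  ⟨nmfPhi n m r J, nmfLabel n m r⟩

/-- The 'left part' states of `D_J`. -/
def NMFState.isLeft {n m r : ℕ} : NMFState n m r → Prop
  | .s => True
  | .si _ => True
  | .si' _ => True
  | .p _ => True
  | _ => False

/-- The 'right part' states of `D_J`. -/
def NMFState.isRight {n m r : ℕ} : NMFState n m r → Prop
  | .t => True
  | .ti _ => True
  | .ti' _ => True
  | .q _ => True
  | _ => False

namespace MDP

variable {S A L : Type} [Fintype S] [Fintype A] [DecidableEq S] [DecidableEq L]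

/-- The vector `M_α(w) 1` of probabilities of emitting the word `w`. -/
def wordProb (D : MDP S A L) (α : S → A → ℝ) (w : List L) : S → ℝ :=
  (D.Mword α w).mulVec 1

/-- The expectation of `g` after one step from `u`. -/
def expect (D : MDP S A L) (α : S → A → ℝ) (g : S → ℝ) (u : S) : ℝ :=
  ∑ v, D.tau α u v * g v

omit [DecidableEq S] [DecidableEq L] in
lemma expect_eq_sum (D : MDP S A L) (α : S → A → ℝ) (g : S → ℝ) (u : S) :
    D.expect α g u = ∑ m, α u m * ∑ v, D.trans u m v * g v := by
  simp only [expect, tau, Finset.sum_mul, Finset.mul_sum, mul_assoc]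
  exact Finset.sum_comm

@[simp] lemma wordProb_nil (D : MDP S A L) (α : S → A → ℝ) (u : S) :
    D.wordProb α [] u = 1 := by
  simp [wordProb, Mword]

lemma wordProb_cons (D : MDP S A L) (α : S → A → ℝ) (a : L) (w : List L) (u : S) :
    D.wordProb α (a :: w) u =
      if D.label u = a then D.expect α (D.wordProb α w) u else 0 := by
  simp only [wordProb, Mword, List.map_cons, List.prod_cons, ← Matrix.mulVec_mulVec]
  rw [Matrix.mulVec, dotProduct]
  split_ifs with h <;> simp [Mmat, h, expect]

end MDP

section NMF

variable {n m r : ℕ} {J : Matrix (Fin n) (Fin m) ℚ}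

lemma sum_dirac_mul {S : Type} [Fintype S] [DecidableEq S] (x : S) (g : S → ℝ) :
    ∑ v, dirac x v * g v = g x := by
  simp [dirac]

lemma sum_sum_mul_dirac_mul {S ι : Type} [Fintype S] [DecidableEq S] [Fintype ι]
    (c : ι → ℝ) (f : ι → S) (g : S → ℝ) :
    ∑ v, (∑ i, c i * dirac (f i) v) * g v = ∑ i, c i * g (f i) := by
  simp only [Finset.sum_mul, mul_assoc]
  rw [Finset.sum_comm]
  simp only [← Finset.mul_sum, sum_dirac_mul]

variable {α : NMFState n m r → NMFAct r m → ℝ}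

/-- At a state with only the unit action, the strategy plays it almost surely. -/
lemma expect_eq_of_unit_action (hα : (nmfMDP n m r J).IsStrategy α)
    (g : NMFState n m r → ℝ) (u : NMFState n m r) (d : NMFState n m r → ℝ)
    (hl : ∀ k, nmfPhi n m r J u (.inl k) = none)
    (hj : ∀ j, nmfPhi n m r J u (.inr (.inl j)) = none)
    (hd : nmfPhi n m r J u (.inr (.inr ())) = some d) :
    (nmfMDP n m r J).expect α g u = ∑ v, d v * g v := by
  obtain ⟨-, hsum, hnone⟩ := hα u
  have h₁ : ∀ k, α u (.inl k) = 0 := fun k => hnone _ (hl k)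
  have h₂ : ∀ j, α u (.inr (.inl j)) = 0 := fun j => hnone _ (hj j)
  simp only [Fintype.sum_sum_type, h₁, h₂] at hsum
  rw [MDP.expect_eq_sum]
  simp only [Fintype.sum_sum_type, h₁, h₂]
  simp at hsum
  simp [hsum, MDP.trans, nmfMDP, hd]

variable (hα : (nmfMDP n m r J).IsStrategy α) (g : NMFState n m r → ℝ)

include hα

lemma expect_s : (nmfMDP n m r J).expect α g .s = ∑ i, 1 / (n : ℝ) * g (.si i) := by
  rw [expect_eq_of_unit_action hα g .s _ (fun _ => rfl) (fun _ => rfl) rfl,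
    ← sum_sum_mul_dirac_mul (fun _ => 1 / (n : ℝ)) .si g]
  refine Finset.sum_congr rfl fun v _ => ?_
  cases v <;> simp [dirac]

lemma expect_t : (nmfMDP n m r J).expect α g .t = ∑ i, 1 / (n : ℝ) * g (.ti i) := by
  rw [expect_eq_of_unit_action hα g .t _ (fun _ => rfl) (fun _ => rfl) rfl,
    ← sum_sum_mul_dirac_mul (fun _ => 1 / (n : ℝ)) .ti g]
  refine Finset.sum_congr rfl fun v _ => ?_
  cases v <;> simp [dirac]

lemma expect_si (i : Fin n) : (nmfMDP n m r J).expect α g (.si i) = g (.si' i) := by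
  rw [expect_eq_of_unit_action hα g (.si i) _ (fun _ => rfl) (fun _ => rfl) rfl, sum_dirac_mul]

lemma expect_si' (i : Fin n) :
    (nmfMDP n m r J).expect α g (.si' i) = ∑ j, (J i j : ℝ) * g (.p j) := by
  rw [expect_eq_of_unit_action hα g (.si' i) _ (fun _ => rfl) (fun _ => rfl) rfl,
    ← sum_sum_mul_dirac_mul (fun j => (J i j : ℝ)) .p g]
  refine Finset.sum_congr rfl fun v _ => ?_
  cases v <;> simp [dirac]

lemma expect_p (j : Fin m) : (nmfMDP n m r J).expect α g (.p j) = g .s := by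
  rw [expect_eq_of_unit_action hα g (.p j) _ (fun _ => rfl) (fun _ => rfl) rfl, sum_dirac_mul]

lemma expect_q (j : Fin m) : (nmfMDP n m r J).expect α g (.q j) = g .t := by
  rw [expect_eq_of_unit_action hα g (.q j) _ (fun _ => rfl) (fun _ => rfl) rfl, sum_dirac_mul]

omit hα in
lemma expect_ti (i : Fin n) : (nmfMDP n m r J).expect α g (.ti i) =
    ∑ k, α (.ti i) (.inl k) * g (.ti' k) := by
  simp [MDP.expect_eq_sum, MDP.trans, nmfMDP, nmfPhi, sum_dirac_mul]

omit hα in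
lemma expect_ti' (k : Fin r) : (nmfMDP n m r J).expect α g (.ti' k) =
    ∑ j, α (.ti' k) (.inr (.inl j)) * g (.q j) := by
  simp [MDP.expect_eq_sum, MDP.trans, nmfMDP, nmfPhi, sum_dirac_mul]

omit hα in
lemma label_nmfMDP (u : NMFState n m r) : (nmfMDP n m r J).label u = nmfLabel n m r u := rfl

/-- On the left part, a label `b_j` resets the chain to `s`. -/
lemma wordProb_append_of_isLeft (w w' : List (NMFLabel n m)) (j : Fin m)
    (u : NMFState n m r) (hu : u.isLeft) :
    (nmfMDP n m r J).wordProb α (w ++ .b j :: w') u =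
      (nmfMDP n m r J).wordProb α (w ++ [.b j]) u * (nmfMDP n m r J).wordProb α w' .s := by
  induction w generalizing u with
  | nil =>
    cases u <;> simp_all [NMFState.isLeft, MDP.wordProb_cons, label_nmfMDP, nmfLabel, expect_p]
  | cons a w ih =>
    have hs := ih .s trivial
    have hsi := fun i => ih (.si i) trivial
    have hsi' := fun i => ih (.si' i) trivial
    have hp := fun j => ih (.p j) trivial
    simp only [List.cons_append, MDP.wordProb_cons, ite_mul, zero_mul]
    congr 1
    cases u <;> first
      | exact hu.elim
      | simp only [expect_s hα, expect_si hα, expect_si' hα, expect_p hα, hs, hsi, hsi', hp,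
          Finset.sum_mul, mul_assoc]

/-- On the right part, a label `b_j` resets the chain to `t`. -/
lemma wordProb_append_of_isRight (w w' : List (NMFLabel n m)) (j : Fin m)
    (u : NMFState n m r) (hu : u.isRight) :
    (nmfMDP n m r J).wordProb α (w ++ .b j :: w') u =
      (nmfMDP n m r J).wordProb α (w ++ [.b j]) u * (nmfMDP n m r J).wordProb α w' .t := by
  induction w generalizing u with
  | nil =>
    cases u <;> simp_all [NMFState.isRight, MDP.wordProb_cons, label_nmfMDP, nmfLabel, expect_q]
  | cons a w ih =>
    have ht := ih .t trivial
    have hti := fun i => ih (.ti i) trivial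
    have hti' := fun k => ih (.ti' k) trivial
    have hq := fun j => ih (.q j) trivial
    simp only [List.cons_append, MDP.wordProb_cons, ite_mul, zero_mul]
    congr 1
    cases u <;> first
      | exact hu.elim
      | simp only [expect_t hα, expect_ti, expect_ti', expect_q hα, ht, hti, hti', hq,
          Finset.sum_mul, mul_assoc]

lemma wordProb_nonneg_of_isLeft (hJ : ∀ i j, 0 ≤ J i j) (w : List (NMFLabel n m))
    (u : NMFState n m r) (hu : u.isLeft) : 0 ≤ (nmfMDP n m r J).wordProb α w u := by
  induction w generalizing u with
  | nil => simp
  | cons a w ih =>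
    rw [MDP.wordProb_cons]
    split_ifs
    · cases u with
      | s =>
        rw [expect_s hα]
        exact Finset.sum_nonneg fun i _ => mul_nonneg (by positivity) (ih _ trivial)
      | si i => rw [expect_si hα]; exact ih _ trivial
      | si' i =>
        rw [expect_si' hα]
        exact Finset.sum_nonneg fun j _ => mul_nonneg (mod_cast hJ i j) (ih _ trivial)
      | p j => rw [expect_p hα]; exact ih _ trivial
      | _ => exact hu.elim
    · exact le_rfl

lemma wordProb_si' (i : Fin n) (j : Fin m) :
    (nmfMDP n m r J).wordProb α [.c, .b j] (.si' i) = J i j := by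
  simp [MDP.wordProb_cons, label_nmfMDP, nmfLabel, expect_si' hα, expect_p hα]

lemma wordProb_si (i : Fin n) (j : Fin m) :
    (nmfMDP n m r J).wordProb α [.a i, .c, .b j] (.si i) = J i j := by
  simp [MDP.wordProb_cons _ _ (NMFLabel.a i), label_nmfMDP, nmfLabel, expect_si hα, wordProb_si' hα]

lemma wordProb_s (i : Fin n) (j : Fin m) :
    (nmfMDP n m r J).wordProb α [.c, .a i, .c, .b j] .s = 1 / (n : ℝ) * J i j := by
  rw [MDP.wordProb_cons, label_nmfMDP, nmfLabel, if_pos rfl, expect_s hα,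
    Finset.sum_eq_single i _ (by simp), wordProb_si hα]
  intro i' _ hi'
  rw [MDP.wordProb_cons, if_neg (by simpa [label_nmfMDP, nmfLabel] using hi'), mul_zero]
  all_goals simp

lemma wordProb_t (i : Fin n) (j : Fin m) :
    (nmfMDP n m r J).wordProb α [.c, .a i, .c, .b j] .t =
      1 / (n : ℝ) * ∑ k, α (.ti i) (.inl k) * α (.ti' k) (.inr (.inl j)) := by
  rw [MDP.wordProb_cons, label_nmfMDP, nmfLabel, if_pos rfl, expect_t hα,
    Finset.sum_eq_single i _ (by simp)]
  · simp [MDP.wordProb_cons, label_nmfMDP, nmfLabel, expect_ti, expect_ti', expect_q hα]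
  · intro i' _ hi'
    rw [MDP.wordProb_cons, if_neg (by simpa [label_nmfMDP, nmfLabel] using hi'), mul_zero]
  all_goals simp

lemma exists_wordProb_pos_of_isLeft (hn : 1 ≤ n)
    (hJ1 : ∀ i, ∑ j, J i j = 1) (u : NMFState n m r) (hu : u.isLeft) :
    ∃ w j, 0 < (nmfMDP n m r J).wordProb α (w ++ [.b j]) u := by
  have hpos : ∀ i, ∃ j, (0 : ℝ) < J i j := fun i => by
    by_contra! h
    have : ∑ j, J i j ≤ 0 := Finset.sum_nonpos fun j _ => mod_cast h j
    rw [hJ1 i] at this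
    norm_num at this
  cases u with
  | s =>
    obtain ⟨j, hj⟩ := hpos ⟨0, hn⟩
    have hn' : (0 : ℝ) < n := mod_cast hn
    exact ⟨[.c, .a ⟨0, hn⟩, .c], j, (wordProb_s hα _ j).symm ▸ by positivity⟩
  | si i =>
    obtain ⟨j, hj⟩ := hpos i
    exact ⟨[.a i, .c], j, (wordProb_si hα i j).symm ▸ hj⟩
  | si' i =>
    obtain ⟨j, hj⟩ := hpos i
    exact ⟨[.c], j, (wordProb_si' hα i j).symm ▸ hj⟩
  | p j =>
    exact ⟨[], j, by simp [MDP.wordProb_cons, label_nmfMDP, nmfLabel, expect_p hα]⟩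
  | _ => exact hu.elim

end NMF

/-- if `J` admits no nonnegative factorization `J = A·W` of inner
dimension `r`, then for every memoryless strategy `α`, every subdistribution `μ₁`
supported on the left part and every subdistribution `μ₂` supported on the right
part, some word `w` witnesses `μ₁·M_α(w)·1 ≠ μ₂·M_α(w)·1`. -/
theorem no_nmf_implies_inequivalent_subdistributions
    (n m r : ℕ) (hn : 1 ≤ n) (hm : 1 ≤ m) (hr : 1 ≤ r)
    (J : Matrix (Fin n) (Fin m) ℚ)
    (hJnonneg : ∀ i j, 0 ≤ J i j) (hJstoch : ∀ i, (∑ j, J i j) = 1)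
    (hno : ¬ ∃ (A : Matrix (Fin n) (Fin r) ℝ) (W : Matrix (Fin r) (Fin m) ℝ),
        (∀ i k, 0 ≤ A i k) ∧ (∀ k j, 0 ≤ W k j) ∧
        J.map (fun x => (x : ℝ)) = A * W) :
    ∀ α, (nmfMDP n m r J).IsStrategy α →
      ∀ μ₁ μ₂ : NMFState n m r → ℝ,
        ((∀ u, 0 ≤ μ₁ u) ∧ (∀ u, μ₁ u ≤ 1) ∧ 0 < (∑ u, μ₁ u) ∧ (∑ u, μ₁ u) ≤ 1) →
        (∀ u, μ₁ u ≠ 0 → u.isLeft) →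
        ((∀ u, 0 ≤ μ₂ u) ∧ (∀ u, μ₂ u ≤ 1) ∧ 0 < (∑ u, μ₂ u) ∧ (∑ u, μ₂ u) ≤ 1) →
        (∀ u, μ₂ u ≠ 0 → u.isRight) →
        ∃ w : List (NMFLabel n m),
          μ₁ ⬝ᵥ ((nmfMDP n m r J).Mword α w).mulVec 1 ≠
            μ₂ ⬝ᵥ ((nmfMDP n m r J).Mword α w).mulVec 1 := by
  rintro α hα μ₁ μ₂ ⟨h₁, -, h₁pos, -⟩ hleft _ hright
  by_contra! heq
  change ∀ w, μ₁ ⬝ᵥ (nmfMDP n m r J).wordProb α w = μ₂ ⬝ᵥ (nmfMDP n m r J).wordProb α w at heq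
  obtain ⟨u, -, hu⟩ := Finset.exists_ne_zero_of_sum_ne_zero h₁pos.ne'
  obtain ⟨w, j₀, hw⟩ :=
    exists_wordProb_pos_of_isLeft hα hn hJstoch u (hleft u hu)
  have hpos : 0 < μ₁ ⬝ᵥ (nmfMDP n m r J).wordProb α (w ++ [.b j₀]) := by
    refine Finset.sum_pos' (fun v _ => ?_)
      ⟨u, Finset.mem_univ u, mul_pos ((h₁ u).lt_of_ne' hu) hw⟩
    by_cases hv : μ₁ v = 0
    · simp [hv]
    · exact mul_nonneg (h₁ v) (wordProb_nonneg_of_isLeft hα hJnonneg _ v (hleft v hv))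
  have hst : ∀ w', (nmfMDP n m r J).wordProb α w' .s = (nmfMDP n m r J).wordProb α w' .t := by
    intro w'
    have hl : μ₁ ⬝ᵥ (nmfMDP n m r J).wordProb α (w ++ .b j₀ :: w') =
        μ₁ ⬝ᵥ (nmfMDP n m r J).wordProb α (w ++ [.b j₀]) *
          (nmfMDP n m r J).wordProb α w' .s := by
      simp only [dotProduct, Finset.sum_mul]
      refine Finset.sum_congr rfl fun v _ => ?_
      by_cases hv : μ₁ v = 0
      · simp [hv]
      · rw [wordProb_append_of_isLeft hα w w' j₀ v (hleft v hv), mul_assoc]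
    have hr : μ₂ ⬝ᵥ (nmfMDP n m r J).wordProb α (w ++ .b j₀ :: w') =
        μ₂ ⬝ᵥ (nmfMDP n m r J).wordProb α (w ++ [.b j₀]) *
          (nmfMDP n m r J).wordProb α w' .t := by
      simp only [dotProduct, Finset.sum_mul]
      refine Finset.sum_congr rfl fun v _ => ?_
      by_cases hv : μ₂ v = 0
      · simp [hv]
      · rw [wordProb_append_of_isRight hα w w' j₀ v (hright v hv), mul_assoc]
    rw [heq, hr, ← heq] at hl
    exact (mul_left_cancel₀ hpos.ne' hl).symm
  refine hno ⟨Matrix.of fun i k => α (.ti i) (.inl k),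
    Matrix.of fun k j => α (.ti' k) (.inr (.inl j)),
    fun i k => (hα _).1 _, fun k j => (hα _).1 _, ?_⟩
  ext i j
  have h := hst [.c, .a i, .c, .b j]
  rw [wordProb_s hα, wordProb_t hα] at h
  have hn' : (1 / (n : ℝ)) ≠ 0 := by positivity
  simpa [Matrix.mul_apply] using mul_left_cancel₀ hn' h
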